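/- Let {Cₙ : n ∈ ω} be an increasing sequence of countable sets with C₀ = ∅ and C = ⋃ₙ Cₙ, let B be an arbitrary set, and let Z, F be closed subsets of ℝ^{B∪C} × ℝ^{B∪C}. Suppose there are continuous maps φₙ, ψₙ : ℝ^{B∪Cₙ} × ℝ^{B∪Cₙ} → ℝ^{B∪Cₙ} × ℝ^{B∪Cₙ} for n ≥ 1 such that: (1) π₁ ∘ φₙ = π₁ and (2) π₁ ∘ ψₙ = π₁; (3) (π_{B∪Cₙ} × π_{B∪Cₙ}) ∘ φₙ₊₁ = π_{B∪Cₙ} × π_{B∪Cₙ} and (4) (π_{B∪Cₙ} × π_{B∪Cₙ}) ∘ ψₙ₊₁ = π_{B∪Cₙ} × π_{B∪Cₙ}; (5) (π_{B∪Cₙ} × π_{B∪Cₙ})(Z) and the image of φₙ are functionally separated in ℝ^{B∪Cₙ} × ℝ^{B∪Cₙ}; (6) (π_{B∪Cₙ} × π_{B∪Cₙ})(F) and the image of ψₙ are functionally separated. Let H₀ : ℝ^{B∪C₀} × ℝ^{B∪C₀} → ℝ^{B∪C₀} × ℝ^{B∪C₀} be a homeomorphism with π₁ ∘ H₀ = π₁,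 and let f, g : ℝ^{B∪C} × ℝ^{B∪C} → ℝ^{B∪C} × ℝ^{B∪C} be continuous maps such that (7) f(Z) = F and g(F) = Z; (8) (g ∘ f)|Z = id_Z and (f ∘ g)|F = id_F; (9) π₁ ∘ f = π₁ and π₁ ∘ g = π₁; (10) (π_{B∪C₀} × π_{B∪C₀}) ∘ f = H₀ ∘ (π_{B∪C₀} × π_{B∪C₀}) and (π_{B∪C₀} × π_{B∪C₀}) ∘ g = H₀⁻¹ ∘ (π_{B∪C₀} × π_{B∪C₀}). Then the homeomorphism h = f|Z : Z → F extends to a homeomorphism H : ℝ^{B∪C} × ℝ^{B∪C} → ℝ^{B∪C} × ℝ^{B∪C} such that π₁ ∘ H = π₁ and (π_B × π_B) ∘ H = H₀ ∘ (π_B × π_B). -/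

import Mathlib

open Set Topology

universe u

/-- Restriction (projection) of `ℝ^A` onto the subproduct `ℝ^D`, `D ⊆ A`. -/
def resTo {A : Type u} (D : Set A) (x : A → ℝ) : ↥D → ℝ := fun d => x d

/-- Projection `π_D × π_D : ℝ^A × ℝ^A → ℝ^D × ℝ^D`. -/
def resToP {A : Type u} (D : Set A) (x : (A → ℝ) × (A → ℝ)) : (↥D → ℝ) × (↥D → ℝ) :=
  (resTo D x.1, resTo D x.2)

/-- Projection `π_D × π_D : ℝ^E × ℝ^E → ℝ^D × ℝ^D` for `D ⊆ E`. -/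
def resSubP {A : Type u} {D E : Set A} (h : D ⊆ E) (x : (↥E → ℝ) × (↥E → ℝ)) :
    (↥D → ℝ) × (↥D → ℝ) :=
  (fun d => x.1 ⟨d.1, h d.2⟩, fun d => x.2 ⟨d.1, h d.2⟩)

/-- Two sets are functionally separated if some continuous `[0,1]`-valued function
is `0` on the first and `1` on the second. -/
def FunctionallySeparated {X : Type*} [TopologicalSpace X] (P Q : Set X) : Prop :=
  ∃ φ : X → ℝ, Continuous φ ∧ (∀ x, φ x ∈ Set.Icc (0 : ℝ) 1) ∧
    (∀ p ∈ P, φ p = 0) ∧ (∀ q ∈ Q, φ q = 1)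

/-- The Klee trick over a base: a homeomorphism between deficient sets that extends to maps of the
ambient space in both directions extends to an autohomeomorphism. -/
theorem exists_klee_homeomorph {T X Q : Type*} [TopologicalSpace T] [TopologicalSpace X]
    [TopologicalSpace Q] [AddCommGroup Q] [IsTopologicalAddGroup Q]
    (p : X → T) (τ : T ≃ₜ T) {Z F : Set X} {f g : X → X}
    (hf : Continuous f) (hg : Continuous g)
    (hfτ : ∀ x, p (f x) = τ (p x))
    (hfZ : ∀ z ∈ Z, f z ∈ F) (hgf : ∀ z ∈ Z, g (f z) = z)
    (hZ : X ≃ₜ T × Q × Q) (hF : X ≃ₜ T × Q × Q)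
    (hZp : ∀ x, (hZ x).1 = p x) (hFp : ∀ x, (hF x).1 = p x)
    (hZ0 : ∀ z ∈ Z, (hZ z).2.2 = 0) (hF0 : ∀ z ∈ F, (hF z).2.2 = 0) :
    ∃ H : X ≃ₜ X, (∀ z ∈ Z, H z = f z) ∧ ∀ x, p (H x) = τ (p x) := by
  let f' : T × Q → Q := fun a => (hF (f (hZ.symm (a.1, a.2, 0)))).2.1
  let g' : T × Q → Q := fun a => (hZ (g (hF.symm (a.1, a.2, 0)))).2.1
  have cf : Continuous f' := by fun_prop
  have cg : Continuous g' := by fun_prop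
  let K : T × Q × Q ≃ₜ T × Q × Q :=
    { toFun := fun a => (τ a.1, a.2.2 + f' (a.1, a.2.1),
        a.2.1 - g' (τ a.1, a.2.2 + f' (a.1, a.2.1)))
      invFun := fun a => (τ.symm a.1, a.2.2 + g' (a.1, a.2.1),
        a.2.1 - f' (τ.symm a.1, a.2.2 + g' (a.1, a.2.1)))
      left_inv := fun a => by simp
      right_inv := fun a => by simp
      continuous_toFun := by fun_prop
      continuous_invFun := by fun_prop }
  refine ⟨(hZ.trans K).trans hF.symm, fun z hz => ?_, fun x => ?_⟩
  · have e1 : (p z, (hZ z).2.1, (0 : Q)) = hZ z := by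
      rw [← hZ0 z hz, ← hZp]
    have e2 : (τ (p z), (hF (f z)).2.1, (0 : Q)) = hF (f z) := by
      rw [← hF0 _ (hfZ z hz), ← hfτ, ← hFp]
    have e3 : f' (p z, (hZ z).2.1) = (hF (f z)).2.1 := by
      simp only [f', e1, Homeomorph.symm_apply_apply]
    have e4 : g' (τ (p z), (hF (f z)).2.1) = (hZ z).2.1 := by
      simp only [g', e2, Homeomorph.symm_apply_apply, hgf z hz]
    have : K (hZ z) = hF (f z) := by
      rw [← e2, ← e1]
      simp [K, e3, e4]
    simp [this]
  · have h1 : ∀ a, p (hF.symm a) = a.1 := fun a => by rw [← hFp]; simp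
    simp [h1, K, hZp]

/-- A continuous function on all sequences that computes the limit of rapidly converging ones. -/
theorem exists_continuous_rapid_limit :
    ∃ γ : (ℕ → ℝ) → ℝ, Continuous γ ∧
      ∀ v u, (∀ l, |v l - u| ≤ (1 / 2) ^ l) → γ v = u := by
  have hs : Summable fun l : ℕ => (2 : ℝ) * (1 / 2) ^ l := summable_geometric_two.mul_left 2
  refine ⟨fun v => v 0 + ∑' l, max (-(2 * (1 / 2) ^ l)) (min (2 * (1 / 2) ^ l) (v (l + 1) - v l)),
    ?_, fun v u h => ?_⟩
  · refine (continuous_apply 0).add (continuous_tsum (fun l => by fun_prop) hs fun l v => ?_)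
    have : (0 : ℝ) ≤ 2 * (1 / 2) ^ l := by positivity
    rw [Real.norm_eq_abs, abs_le]
    exact ⟨le_max_left _ _, max_le (by linarith) (min_le_left _ _)⟩
  · have h1 : ∀ l, max (-(2 * (1 / 2 : ℝ) ^ l)) (min (2 * (1 / 2) ^ l) (v (l + 1) - v l)) =
        v (l + 1) - v l := fun l => by
      have a := abs_le.1 (h l)
      have b := abs_le.1 (h (l + 1))
      have c : (0 : ℝ) < (1 / 2) ^ l := by positivity
      rw [pow_succ] at b
      rw [min_eq_right (by linarith [a.1, b.2]), max_eq_right (by linarith [a.2, b.1])]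
    have hv : Filter.Tendsto v Filter.atTop (𝓝 u) := by
      rw [tendsto_iff_dist_tendsto_zero]
      refine squeeze_zero (fun _ => dist_nonneg) (fun l => h l) ?_
      exact tendsto_pow_atTop_nhds_zero_of_lt_one (by norm_num) (by norm_num)
    have hsum : Summable fun l => v (l + 1) - v l := by
      refine Summable.of_norm_bounded hs fun l => ?_
      have a := abs_le.1 (h l)
      have b := abs_le.1 (h (l + 1))
      have c : (0 : ℝ) < (1 / 2) ^ l := by positivity
      rw [pow_succ] at b
      rw [Real.norm_eq_abs, abs_le]
      constructor <;> linarith [a.1, a.2, b.1, b.2]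
    have h2 : ∑' l, (v (l + 1) - v l) = u - v 0 := by
      refine tendsto_nhds_unique hsum.hasSum.tendsto_sum_nat ?_
      simp only [Finset.sum_range_sub]
      exact hv.sub_const _
    simp only [h1, h2]
    ring

section Triangular

variable {T D : Type*}

/-- A map of `T × ℝ^D` over `T` that changes only the coordinates of rank `k`, in a way that
depends only on the coordinates of rank at most `k`. -/
structure IsBlockMap (ρ : D → ℕ) (k : ℕ) (G : T × (D → ℝ) → T × (D → ℝ)) : Prop where
  fst_eq : ∀ w, (G w).1 = w.1
  eq_of_ne : ∀ w d, ρ d ≠ k → (G w).2 d = w.2 d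
  congr_le : ∀ t y y', (∀ d, ρ d ≤ k → y d = y' d) →
    ∀ d, ρ d ≤ k → (G (t, y)).2 d = (G (t, y')).2 d

theorem IsBlockMap.comp {ρ : D → ℕ} {k : ℕ} {G G' : T × (D → ℝ) → T × (D → ℝ)}
    (h : IsBlockMap ρ k G) (h' : IsBlockMap ρ k G') : IsBlockMap ρ k (G ∘ G') where
  fst_eq w := (h.fst_eq _).trans (h'.fst_eq w)
  eq_of_ne w d hd := (h.eq_of_ne _ d hd).trans (h'.eq_of_ne w d hd)
  congr_le t y y' hy d hd := by
    have e : ∀ y, G' (t, y) = (t, (G' (t, y)).2) := fun y => Prod.ext (h'.fst_eq _) rfl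
    rw [Function.comp_apply, Function.comp_apply, e y, e y']
    exact h.congr_le t _ _ (h'.congr_le t y y' hy) d hd

open scoped Classical in
theorem isBlockMap_ite {ρ : D → ℕ} {k : ℕ} {s : Set D} (hs : ∀ d ∈ s, ρ d = k)
    (q : T × (D → ℝ) → D → ℝ)
    (hq : ∀ t y y', (∀ d, ρ d ≤ k → y d = y' d) → ∀ d ∈ s, q (t, y) d = q (t, y') d)
    {G : T × (D → ℝ) → T × (D → ℝ)}
    (hG : ∀ w, G w = (w.1, fun d => if d ∈ s then q w d else w.2 d)) :
    IsBlockMap ρ k G where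
  fst_eq w := by rw [hG]
  eq_of_ne w d hd := by
    rw [hG]
    exact if_neg fun h => hd (hs d h)
  congr_le t y y' hy d hd := by
    rw [hG, hG]
    by_cases h : d ∈ s
    · simpa [h] using hq t y y' hy d h
    · simpa [h] using hy d hd

variable [TopologicalSpace T]

/-- Block maps, one for each rank, assemble into a triangular homeomorphism. -/
theorem exists_triangular_homeomorph (ρ : D → ℕ)
    (H : ℕ → (T × (D → ℝ)) ≃ₜ (T × (D → ℝ))) (hH : ∀ k, IsBlockMap ρ k (H k))
    (hS : ∀ k, IsBlockMap ρ k (H k).symm) :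
    ∃ Φ : (T × (D → ℝ)) ≃ₜ (T × (D → ℝ)), ∀ w, (Φ w).1 = w.1 ∧
      ∀ d, (Φ w).2 d = (H (ρ d) w).2 d := by
  let v : ℕ → T × (D → ℝ) → T × (D → ℝ) := fun k => Nat.rec id (fun k r => (H k).symm ∘ r) k
  have v0 : ∀ w, v 0 w = w := fun w => rfl
  have vs : ∀ k w, v (k + 1) w = (H k).symm (v k w) := fun k w => rfl
  have vc : ∀ k, Continuous (v k) := fun k => by
    induction k with
    | zero => exact continuous_id
    | succ k ih => exact (H k).symm.continuous.comp ih
  have vfst : ∀ k w, (v k w).1 = w.1 := fun k w => by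
    induction k with
    | zero => rfl
    | succ k ih => rw [vs, (hS k).fst_eq, ih]
  have vge : ∀ k w d, k ≤ ρ d → (v k w).2 d = w.2 d := fun k w d => by
    induction k with
    | zero => exact fun _ => rfl
    | succ k ih => exact fun h => by rw [vs, (hS k).eq_of_ne _ _ (by omega), ih (by omega)]
  have vlt : ∀ k w d, ρ d < k → (v k w).2 d = (v (ρ d + 1) w).2 d := fun k w d h => by
    induction k, h using Nat.le_induction with
    | base => rfl
    | succ k hk ih =>
      rw [vs, (hS k).eq_of_ne _ _ (by simp at hk; omega), ih]
  have key : ∀ k, ∀ G : T × (D → ℝ) → T × (D → ℝ), IsBlockMap ρ k G → ∀ w w', w.1 = w'.1 →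
      (∀ d, ρ d ≤ k → w.2 d = w'.2 d) → ∀ d, ρ d ≤ k → (G w).2 d = (G w').2 d := by
    rintro k G hG ⟨t, y⟩ ⟨t', y'⟩ rfl h
    exact hG.congr_le _ _ _ h
  let Φ : T × (D → ℝ) → T × (D → ℝ) := fun w => (w.1, fun d => (H (ρ d) w).2 d)
  let Ψ : T × (D → ℝ) → T × (D → ℝ) := fun w => (w.1, fun d => (v (ρ d + 1) w).2 d)
  have hΦΨ : ∀ w, Φ (Ψ w) = w := fun w => by
    refine Prod.ext rfl (funext fun d => ?_)
    have : (H (ρ d) (Ψ w)).2 d = (H (ρ d) (v (ρ d + 1) w)).2 d :=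
      key _ _ (hH (ρ d)) (Ψ w) _ (vfst (ρ d + 1) w).symm
        (fun d' hd' => (vlt (ρ d + 1) w d' (by omega)).symm) d le_rfl
    simp only [Φ, this]
    rw [vs, Homeomorph.apply_symm_apply, vge _ _ _ le_rfl]
  have hΨΦ : ∀ w, Ψ (Φ w) = w := fun w => by
    have main : ∀ k d, ρ d < k → (v k (Φ w)).2 d = w.2 d := fun k => by
      induction k with
      | zero => intro d hd; omega
      | succ k ih =>
        intro d hd
        have e : (H k).symm (H k w) = w := by simp
        conv_rhs => rw [← e]
        rw [vs]
        refine key _ _ (hS k) _ _ (by rw [vfst, (hH k).fst_eq]) (fun d' hd' => ?_) d (by omega)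
        rcases hd'.lt_or_eq with h | h
        · rw [ih d' h, (hH k).eq_of_ne _ _ h.ne]
        · rw [vge _ _ _ h.ge, ← h]
    exact Prod.ext rfl (funext fun d => main (ρ d + 1) d (by omega))
  refine ⟨⟨⟨Φ, Ψ, hΨΦ, hΦΨ⟩, ?_, ?_⟩, fun w => ⟨rfl, fun d => rfl⟩⟩
  · refine continuous_fst.prodMk (continuous_pi fun d => ?_)
    exact (continuous_apply d).comp (continuous_snd.comp (H (ρ d)).continuous)
  · refine continuous_fst.prodMk (continuous_pi fun d => ?_)
    exact (continuous_apply d).comp (continuous_snd.comp (vc (ρ d + 1)))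

open scoped Classical in
theorem exists_affine_homeomorph (s : Set D) {m : T × (D → ℝ) → ℝ} {c : T × (D → ℝ) → D → ℝ}
    (hm : Continuous m) (hc : Continuous c) (hm0 : ∀ w, m w ≠ 0)
    (hms : ∀ t y y', (∀ d ∉ s, y d = y' d) → m (t, y) = m (t, y'))
    (hcs : ∀ t y y', (∀ d ∉ s, y d = y' d) → c (t, y) = c (t, y')) :
    ∃ G : (T × (D → ℝ)) ≃ₜ (T × (D → ℝ)),
      (∀ w, G w = (w.1, fun d => if d ∈ s then m w * (w.2 d - c w d) else w.2 d)) ∧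
      (∀ w, G.symm w = (w.1, fun d => if d ∈ s then w.2 d / m w + c w d else w.2 d)) := by
  refine ⟨⟨⟨fun w => (w.1, fun d => if d ∈ s then m w * (w.2 d - c w d) else w.2 d),
    fun w => (w.1, fun d => if d ∈ s then w.2 d / m w + c w d else w.2 d), ?_, ?_⟩, ?_, ?_⟩,
    fun w => rfl, fun w => rfl⟩
  · rintro ⟨t, y⟩
    refine Prod.ext rfl (funext fun d => ?_)
    simp only
    rw [hms t _ y fun d hd => if_neg hd, hcs t _ y fun d hd => if_neg hd]
    split_ifs
    · field_simp [hm0 (t, y)]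
      ring
    · rfl
  · rintro ⟨t, y⟩
    refine Prod.ext rfl (funext fun d => ?_)
    simp only
    rw [hms t _ y fun d hd => if_neg hd, hcs t _ y fun d hd => if_neg hd]
    split_ifs
    · field_simp [hm0 (t, y)]
      ring
    · rfl
  · refine continuous_fst.prodMk (continuous_pi fun d => ?_)
    by_cases h : d ∈ s
    · simp only [h, if_true]; fun_prop
    · simp only [h, if_false]; fun_prop
  · refine continuous_fst.prodMk (continuous_pi fun d => ?_)
    by_cases h : d ∈ s
    · simp only [h, if_true]
      exact Continuous.add (Continuous.div (by fun_prop) hm hm0) (by fun_prop)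
    · simp only [h, if_false]; fun_prop

end Triangular

section Deficiency

variable {T D : Type*} [TopologicalSpace T]

open scoped Classical in
/-- A continuous gauge around the section `σ` that grows at least linearly along rays through the
zeros of `lam`. -/
theorem exists_continuous_gauge (s R : Set D) {lam : T × (D → ℝ) → ℝ} {σ : T × (D → ℝ) → D → ℝ}
    (hlam : Continuous lam) (hσ : Continuous σ)
    (hlamR : ∀ t y y', (∀ d ∈ R, y d = y' d) → lam (t, y) = lam (t, y'))
    (hσR : ∀ t y y', (∀ d ∈ R \ s, y d = y' d) → σ (t, y) = σ (t, y'))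
    (hlam1 : ∀ w, (∀ d ∈ s, w.2 d = σ w d) → lam w = 1) :
    ∃ p : T × (D → ℝ) → ℝ, Continuous p ∧
      (∀ t y y', (∀ d ∈ R, y d = y' d) → p (t, y) = p (t, y')) ∧
      ∀ w, lam w = 0 → ∀ c, 1 ≤ c →
        c ≤ p (w.1, fun d => if d ∈ s then c * (w.2 d - σ w d) else w.2 d) := by
  let e : T × (D → ℝ) → ℝ → T × (D → ℝ) := fun w r =>
    (w.1, fun d => if d ∈ s then σ w d + r * w.2 d else w.2 d)
  let q : T × (D → ℝ) → ℝ → ℝ := fun w r => max 0 (1 - 2 * lam (e w r)) / r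
  have he : Continuous fun x : (T × (D → ℝ)) × ℝ => e x.1 x.2 := by
    refine (continuous_fst.comp continuous_fst).prodMk (continuous_pi fun d => ?_)
    by_cases h : d ∈ s
    · simp only [h, if_true]; fun_prop
    · simp only [h, if_false]; fun_prop
  have hn : Continuous fun x : (T × (D → ℝ)) × ℝ => max 0 (1 - 2 * lam (e x.1 x.2)) := by
    fun_prop
  have hσe : ∀ (t : T) (y u : D → ℝ), σ (t, fun d => if d ∈ s then u d else y d) = σ (t, y) :=
    fun t y u => hσR _ _ _ fun d hd => if_neg hd.2
  have hq : Continuous (Function.uncurry q) := by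
    refine continuous_iff_continuousAt.2 fun ⟨w, r⟩ => ?_
    rcases eq_or_ne r 0 with rfl | hr
    · have h1 : lam (e w 0) = 1 := by
        refine hlam1 _ fun d hd => ?_
        simp only [e, hd, if_true, zero_mul, add_zero]
        rw [hσe w.1 w.2]
      have h2 : ∀ᶠ x in 𝓝 (w, (0 : ℝ)), (1 / 2 : ℝ) < lam (e x.1 x.2) := by
        refine (hlam.comp he).continuousAt.eventually_const_lt ?_
        simp only [Function.comp_apply, h1]
        norm_num
      have h3 : (fun _ => (0 : ℝ)) =ᶠ[𝓝 (w, (0 : ℝ))] Function.uncurry q := by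
        filter_upwards [h2] with x hx
        simp only [Function.uncurry, q]
        rw [max_eq_left (by linarith), zero_div]
      exact continuousAt_const.congr h3
    · exact hn.continuousAt.div continuousAt_snd hr
  have hcont : ∀ w, Continuous (q w) := fun w => hq.comp (Continuous.prodMk_right w)
  refine ⟨fun w => sSup (q w '' Icc 0 1), isCompact_Icc.continuous_sSup hq, fun t y y' h => ?_,
    fun w hw c hc => ?_⟩
  · have : q (t, y) = q (t, y') := by
      funext r
      simp only [q]
      rw [hlamR t _ _ fun d hd => ?_]
      simp only [hσR t y y' fun d hd => h d hd.1, h d hd]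
    simp only [this]
  · have hc0 : 0 < c := by linarith
    set w' : T × (D → ℝ) := (w.1, fun d => if d ∈ s then c * (w.2 d - σ w d) else w.2 d)
    have h1 : e w' c⁻¹ = w := by
      refine Prod.ext rfl (funext fun d => ?_)
      simp only [e, w']
      rw [hσe w.1 w.2]
      split_ifs
      · rw [inv_mul_cancel_left₀ hc0.ne']; ring
      · rfl
    have h2 : q w' c⁻¹ = c := by
      simp only [q, h1, hw]
      norm_num
    refine le_csSup (isCompact_Icc.bddAbove_image (hcont w').continuousOn)
      ⟨c⁻¹, ⟨by positivity, inv_le_one_of_one_le₀ hc⟩, h2⟩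

/-- A block map making the coordinate `a` small on the zeros of `lam`. -/
theorem exists_squeezing_blockMap (ρ : D → ℕ) (k : ℕ) {lam : T × (D → ℝ) → ℝ}
    {σ : T × (D → ℝ) → D → ℝ} (hlam : Continuous lam) (hσ : Continuous σ)
    (hlam_le : ∀ t y y', (∀ d, ρ d ≤ 2 * k → y d = y' d) → lam (t, y) = lam (t, y'))
    (hσ_lt : ∀ t y y', (∀ d, ρ d < 2 * k → y d = y' d) → σ (t, y) = σ (t, y'))
    (hlam1 : ∀ w, (∀ d, ρ d = 2 * k → w.2 d = σ w d) → lam w = 1)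
    {a : D} (ha : ρ a = 2 * k + 1) :
    ∃ H : (T × (D → ℝ)) ≃ₜ (T × (D → ℝ)), IsBlockMap (fun d => ρ d / 2) k H ∧
      IsBlockMap (fun d => ρ d / 2) k H.symm ∧
      ∀ w, lam w = 0 → |(H w).2 a| ≤ (1 / 2) ^ k := by
  classical
  obtain ⟨p, hp, hpR, hple⟩ := exists_continuous_gauge {d | ρ d = 2 * k} {d | ρ d ≤ 2 * k}
    hlam hσ hlam_le (fun t y y' h => hσ_lt t y y' fun d hd => h d ⟨hd.le, hd.ne⟩) hlam1
  have hm0 : ∀ w : T × (D → ℝ), 2 ^ k * (1 + |w.2 a|) ≠ 0 := fun w => by positivity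
  have hp0 : ∀ w, (max 1 (p w)) ≠ 0 := fun w => (lt_max_of_lt_left one_pos).ne'
  have has : a ∉ {d | ρ d = 2 * k} := fun h => by simp only [mem_ofPred_eq] at h; omega
  obtain ⟨G, hG, hG'⟩ := exists_affine_homeomorph {d | ρ d = 2 * k}
    (m := fun w : T × (D → ℝ) => 2 ^ k * (1 + |w.2 a|)) (c := σ) (by fun_prop) hσ hm0
    (fun t y y' h => by simp only [h a has])
    (fun t y y' h => hσ_lt t y y' fun d hd => h d hd.ne)
  obtain ⟨V, hV, hV'⟩ := exists_affine_homeomorph {a}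
    (m := fun w => (max 1 (p w))⁻¹) (c := fun _ _ => 0) (by fun_prop (disch := exact hp0 _))
    (by fun_prop) (fun w => inv_ne_zero (hp0 w))
    (fun t y y' h => by
      rw [hpR t y y' fun d hd => h d fun hda => ?_]
      rw [mem_singleton_iff.1 hda, mem_ofPred_eq] at hd
      omega)
    (fun _ _ _ _ => rfl)
  have hs1 : ∀ d ∈ {d | ρ d = 2 * k}, ρ d / 2 = k := fun d hd => by
    simp only [mem_ofPred_eq] at hd; omega
  have hs2 : ∀ d ∈ ({a} : Set D), ρ d / 2 = k := fun d hd => by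
    rw [mem_singleton_iff.1 hd]; omega
  have hσk : ∀ t y y', (∀ d, ρ d / 2 ≤ k → y d = y' d) → σ (t, y) = σ (t, y') :=
    fun t y y' h => hσ_lt t y y' fun d hd => h d (by omega)
  have hpk : ∀ t y y', (∀ d, ρ d / 2 ≤ k → y d = y' d) → p (t, y) = p (t, y') :=
    fun t y y' h => hpR t y y' fun d hd => h d (by simp only [mem_ofPred_eq] at hd; omega)
  refine ⟨G.trans V, ?_, ?_, fun w hw => ?_⟩
  · change IsBlockMap _ k (V ∘ G)
    refine IsBlockMap.comp (isBlockMap_ite (G := V) hs2 _ (fun t y y' h d hd => ?_) hV)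
      (isBlockMap_ite (G := G) hs1 _ (fun t y y' h d hd => ?_) hG)
    · simp only [hpk t y y' h, h d (hs2 d hd).le]
    · simp only [hσk t y y' h, h a (by omega), h d (hs1 d hd).le]
  · change IsBlockMap _ k (G.symm ∘ V.symm)
    refine IsBlockMap.comp (isBlockMap_ite (G := G.symm) hs1 _ (fun t y y' h d hd => ?_) hG')
      (isBlockMap_ite (G := V.symm) hs2 _ (fun t y y' h d hd => ?_) hV')
    · simp only [hσk t y y' h, h a (by omega), h d (hs1 d hd).le]
    · simp only [hpk t y y' h, h d (hs2 d hd).le]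
  · have h1 : 2 ^ k * (1 + |w.2 a|) ≤ p (G w) := by
      rw [hG]
      refine hple w hw _ (one_le_mul_of_one_le_of_one_le (one_le_pow₀ one_le_two) ?_)
      linarith [abs_nonneg (w.2 a)]
    have h2 : (G w).2 a = w.2 a := by
      rw [hG]; exact if_neg has
    have h3 : ((G.trans V) w).2 a = (max 1 (p (G w)))⁻¹ * w.2 a := by
      rw [Homeomorph.trans_apply, hV]
      simp [h2]
    have h4 : 0 < max 1 (p (G w)) := lt_max_of_lt_left one_pos
    rw [h3, abs_mul, abs_inv, abs_of_pos h4, one_div, inv_pow, inv_mul_le_iff₀ h4,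
      ← div_eq_mul_inv, le_div_iff₀ (by positivity)]
    have h5 := le_max_right 1 (p (G w))
    have h6 : (0 : ℝ) < 2 ^ k := by positivity
    nlinarith

theorem exists_squeezing_homeomorph (ρ : D → ℕ) {lam : ℕ → T × (D → ℝ) → ℝ}
    {σ : ℕ → T × (D → ℝ) → D → ℝ} (hlam : ∀ n, Continuous (lam n)) (hσ : ∀ n, Continuous (σ n))
    (hlam_le : ∀ n t y y', (∀ d, ρ d ≤ n → y d = y' d) → lam n (t, y) = lam n (t, y'))
    (hσ_lt : ∀ n t y y', (∀ d, ρ d < n → y d = y' d) → σ n (t, y) = σ n (t, y'))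
    (hlam1 : ∀ n w, (∀ d, ρ d = n → w.2 d = σ n w d) → lam n w = 1)
    {a : ℕ → D} (ha : ∀ k, ρ (a k) = 2 * k + 1) :
    ∃ Φ : (T × (D → ℝ)) ≃ₜ (T × (D → ℝ)), (∀ w, (Φ w).1 = w.1) ∧
      ∀ w, (∀ n, lam n w = 0) → ∀ k, |(Φ w).2 (a k)| ≤ (1 / 2) ^ k := by
  choose H hH hS hle using fun k => exists_squeezing_blockMap ρ k (hlam (2 * k)) (hσ (2 * k))
    (hlam_le _) (hσ_lt _) (hlam1 _) (ha k)
  obtain ⟨Φ, hΦ⟩ := exists_triangular_homeomorph (fun d => ρ d / 2) H hH hS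
  refine ⟨Φ, fun w => (hΦ w).1, fun w hw k => ?_⟩
  have hk : ρ (a k) / 2 = k := by rw [ha]; omega
  rw [(hΦ w).2, hk]
  exact hle k w (hw _)

/-- If infinitely many coordinates of a set are rapidly small, then they can be absorbed so that
the set becomes deficient. -/
theorem exists_deficient_homeomorph [Countable D] {a : ℕ → D} (ha : Function.Injective a) :
    ∃ Ψ : (T × (D → ℝ)) ≃ₜ (T × (ℕ → ℝ) × (ℕ → ℝ)), (∀ w, (Ψ w).1 = w.1) ∧
      ∀ w, (∀ k, |w.2 (a k)| ≤ (1 / 2) ^ k) → (Ψ w).2.2 = 0 := by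
  classical
  obtain ⟨γ, hγ, hγu⟩ := exists_continuous_rapid_limit
  let b : ℕ → ℕ → D := fun j l => a (Nat.pair j l)
  let i : D → ℕ := fun d => (Nat.unpair (Function.invFun a d)).1
  have hib : ∀ j l, i (b j l) = j := fun j l => by
    simp only [i, b, Function.leftInverse_invFun ha _, Nat.unpair_pair]
  have hb : ∀ j l j' l', b j l = b j' l' → j = j' ∧ l = l' := fun j l j' l' h =>
    Nat.pair_eq_pair.1 (ha h)
  let s : Set D := range fun j => b j 0
  have hbs : ∀ j l, b j (l + 1) ∉ s := by
    rintro j l ⟨j', h⟩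
    have := (hb _ _ _ _ h).2
    omega
  obtain ⟨G, hG, -⟩ := exists_affine_homeomorph (T := T) {d | ∃ j l, b j (l + 1) = d}
    (m := fun _ => 1) (c := fun w d => -w.2 (b (i d) 0)) continuous_const (by fun_prop)
    (fun _ => one_ne_zero) (fun _ _ _ _ => rfl) (fun t y y' h => by
      funext d
      simp only
      rw [h]
      rintro ⟨j, l, hjl⟩
      have := (hb _ _ _ _ hjl).2
      omega)
  obtain ⟨V, hV, -⟩ := exists_affine_homeomorph (T := T) s
    (m := fun _ => 1) (c := fun w d => γ fun l => w.2 (b (i d) (l + 1))) continuous_const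
    (by fun_prop) (fun _ => one_ne_zero) (fun _ _ _ _ => rfl) (fun t y y' h => by
      funext d
      simp only [fun l => h _ (hbs (i d) l)])
  have hzero : ∀ w, (∀ k, |w.2 (a k)| ≤ (1 / 2) ^ k) → ∀ d ∈ s, (V (G w)).2 d = 0 := by
    rintro w hw _ ⟨j, rfl⟩
    have h0 : (G w).2 (b j 0) = w.2 (b j 0) := by
      rw [hG]
      refine if_neg ?_
      rintro ⟨j', l, h⟩
      have := (hb _ _ _ _ h).2
      omega
    have h1 : ∀ l, (G w).2 (b j (l + 1)) = w.2 (b j (l + 1)) + w.2 (b j 0) := fun l => by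
      rw [hG]
      simp only
      rw [if_pos ⟨j, l, rfl⟩, hib]
      ring
    have h2 : γ (fun l => w.2 (b j (l + 1)) + w.2 (b j 0)) = w.2 (b j 0) := by
      refine hγu _ _ fun l => ?_
      rw [add_sub_cancel_right]
      refine (hw _).trans (pow_le_pow_of_le_one (by norm_num) (by norm_num) ?_)
      exact (Nat.le_succ l).trans (Nat.right_le_pair j (l + 1))
    rw [hV]
    simp only
    rw [if_pos ⟨j, rfl⟩, hib]
    simp only [h0, h1, h2]
    ring
  have inf1 : Infinite {d // d ∉ s} := Infinite.of_injective
    (fun j => (⟨b j 1, hbs j 0⟩ : {d // d ∉ s})) fun j j' h =>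
      (hb _ _ _ _ (Subtype.ext_iff.1 h)).1
  have inf2 : Infinite {d // ¬ d ∉ s} := Infinite.of_injective
    (fun j => (⟨b j 0, not_not.2 ⟨j, rfl⟩⟩ : {d // ¬ d ∉ s})) fun j j' h =>
      (hb _ _ _ _ (Subtype.ext_iff.1 h)).1
  obtain ⟨e1⟩ : Nonempty ({d // d ∉ s} ≃ ℕ) := nonempty_equiv_of_countable
  obtain ⟨e2⟩ : Nonempty ({d // ¬ d ∉ s} ≃ ℕ) := nonempty_equiv_of_countable
  let S : (D → ℝ) ≃ₜ (ℕ → ℝ) × (ℕ → ℝ) :=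
    (Homeomorph.piEquivPiSubtypeProd (fun d => d ∉ s) fun _ => ℝ).trans
      ((Homeomorph.piCongrLeft (Y := fun _ => ℝ) e1).prodCongr
        (Homeomorph.piCongrLeft (Y := fun _ => ℝ) e2))
  have hS : ∀ y, (∀ d ∈ s, y d = 0) → (S y).2 = 0 := fun y hy => by
    funext n
    obtain ⟨d, rfl⟩ := e2.surjective n
    have : (S y).2 (e2 d) = y d := Equiv.piCongrLeft_apply_apply (P := fun _ => ℝ) e2 _ d
    rw [this]
    exact hy _ (not_not.1 d.2)
  refine ⟨(G.trans V).trans ((Homeomorph.refl T).prodCongr S), fun w => ?_, fun w hw => ?_⟩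
  · simp [hV, hG]
  · exact hS _ (hzero w hw)

theorem exists_deficient_homeomorph_of_holes [Countable D] (ρ : D → ℕ)
    {lam : ℕ → T × (D → ℝ) → ℝ} {σ : ℕ → T × (D → ℝ) → D → ℝ}
    (hlam : ∀ n, Continuous (lam n)) (hσ : ∀ n, Continuous (σ n))
    (hlam_le : ∀ n t y y', (∀ d, ρ d ≤ n → y d = y' d) → lam n (t, y) = lam n (t, y'))
    (hσ_lt : ∀ n t y y', (∀ d, ρ d < n → y d = y' d) → σ n (t, y) = σ n (t, y'))
    (hlam1 : ∀ n w, (∀ d, ρ d = n → w.2 d = σ n w d) → lam n w = 1)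
    {Z : Set (T × (D → ℝ))} (hZ : Z.Nonempty) (hlam0 : ∀ n, ∀ z ∈ Z, lam n z = 0) :
    ∃ Ψ : (T × (D → ℝ)) ≃ₜ (T × (ℕ → ℝ) × (ℕ → ℝ)), (∀ w, (Ψ w).1 = w.1) ∧
      ∀ z ∈ Z, (Ψ z).2.2 = 0 := by
  have hρ : ∀ n, ∃ d, ρ d = n := fun n => by
    by_contra! h
    obtain ⟨z, hz⟩ := hZ
    have := hlam1 n z fun d hd => absurd hd (h d)
    rw [hlam0 n z hz] at this
    exact zero_ne_one this
  choose a ha using fun k => hρ (2 * k + 1)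
  obtain ⟨Φ, hΦ1, hΦ⟩ := exists_squeezing_homeomorph ρ hlam hσ hlam_le hσ_lt hlam1 ha
  have hinj : Function.Injective a := fun k k' h => by
    have := congrArg ρ h
    rw [ha, ha] at this
    omega
  obtain ⟨Ψ, hΨ1, hΨ⟩ := exists_deficient_homeomorph (T := T) hinj
  exact ⟨Φ.trans Ψ, fun w => by rw [Homeomorph.trans_apply, hΨ1, hΦ1],
    fun z hz => hΨ _ (hΦ z fun n => hlam0 n z hz)⟩

end Deficiency

section Product

variable {A : Type u}

theorem continuous_resTo (S : Set A) : Continuous (resTo S) :=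
  continuous_pi fun d => continuous_apply d.1

theorem continuous_resToP (S : Set A) : Continuous (resToP S) :=
  ((continuous_resTo S).comp continuous_fst).prodMk ((continuous_resTo S).comp continuous_snd)

open scoped Classical in
/-- Splits off from `ℝ^A × ℝ^A` the coordinates of the second factor outside `S`. -/
noncomputable def splitHomeomorph (S : Set A) :
    ((A → ℝ) × (A → ℝ)) ≃ₜ ((A → ℝ) × (↥S → ℝ)) × ({a // a ∉ S} → ℝ) where
  toFun x := ((x.1, resTo S x.2), fun d => x.2 d)
  invFun w := (w.1.1, fun a => if h : a ∈ S then w.1.2 ⟨a, h⟩ else w.2 ⟨a, h⟩)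
  left_inv x := by
    refine Prod.ext rfl (funext fun a => ?_)
    by_cases h : a ∈ S <;> simp [h, resTo]
  right_inv w := by
    refine Prod.ext (Prod.ext rfl (funext fun a => ?_)) (funext fun a => ?_)
    · simp [resTo]
    · simp [a.2]
  continuous_toFun := by
    have := continuous_resTo S
    fun_prop
  continuous_invFun := by
    refine Continuous.prodMk (by fun_prop) (continuous_pi fun a => ?_)
    by_cases h : a ∈ S <;> simp only [h, dif_pos, dif_neg, not_false_eq_true] <;> fun_prop

theorem splitHomeomorph_symm_fst (S : Set A) (w) : ((splitHomeomorph S).symm w).1 = w.1.1 := rfl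

theorem splitHomeomorph_symm_snd_of_mem {S : Set A} (w) {a : A} (h : a ∈ S) :
    ((splitHomeomorph S).symm w).2 a = w.1.2 ⟨a, h⟩ := dif_pos h

theorem splitHomeomorph_symm_snd_of_notMem {S : Set A} (w) {a : A} (h : a ∉ S) :
    ((splitHomeomorph S).symm w).2 a = w.2 ⟨a, h⟩ := dif_neg h

theorem exists_deficient_homeomorph_of_separated
    (B : Set A) (Cseq : ℕ → Set A) (hCcount : ∀ n, (Cseq n).Countable)
    (hCmono : ∀ n, Cseq n ⊆ Cseq (n + 1))
    (hcover : B ∪ (⋃ n, Cseq n) = Set.univ)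
    {Z : Set ((A → ℝ) × (A → ℝ))} (hZ : Z.Nonempty)
    (φ : ∀ n, (↥(B ∪ Cseq n) → ℝ) × (↥(B ∪ Cseq n) → ℝ) →
      (↥(B ∪ Cseq n) → ℝ) × (↥(B ∪ Cseq n) → ℝ))
    (hφc : ∀ n, Continuous (φ n))
    (hφ1 : ∀ n, 1 ≤ n → ∀ x, (φ n x).1 = x.1)
    (hφinv : ∀ n, ∀ x, resSubP (Set.union_subset_union_right B (hCmono n)) (φ (n + 1) x) =
      resSubP (Set.union_subset_union_right B (hCmono n)) x)
    (hφsep : ∀ n, 1 ≤ n →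
      FunctionallySeparated (resToP (B ∪ Cseq n) '' Z) (Set.range (φ n))) :
    ∃ Ψ : ((A → ℝ) × (A → ℝ)) ≃ₜ
        ((A → ℝ) × (↥(B ∪ Cseq 0) → ℝ)) × (ℕ → ℝ) × (ℕ → ℝ),
      (∀ x, (Ψ x).1 = (x.1, resTo (B ∪ Cseq 0) x.2)) ∧ ∀ z ∈ Z, (Ψ z).2.2 = 0 := by
  classical
  let S : Set A := B ∪ Cseq 0
  let e := splitHomeomorph S
  have hmono : Monotone Cseq := monotone_nat_of_le_succ hCmono
  have hex : ∀ d : {a // a ∉ S}, ∃ n, d.1 ∈ Cseq (n + 1) := fun d => by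
    have h : d.1 ∈ B ∪ ⋃ n, Cseq n := hcover ▸ mem_univ _
    rcases h with h | h
    · exact absurd (Or.inl h) d.2
    · obtain ⟨n, hn⟩ := mem_iUnion.1 h
      exact ⟨n, hCmono n hn⟩
  let ρ : {a // a ∉ S} → ℕ := fun d => Nat.find (hex d)
  have hρ : ∀ d n, ρ d ≤ n ↔ d.1 ∈ B ∪ Cseq (n + 1) := fun d n => by
    constructor
    · intro h
      exact Or.inr (hmono (Nat.succ_le_succ h) (Nat.find_spec (hex d)))
    · rintro (h | h)
      · exact absurd (Or.inl h) d.2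
      · exact Nat.find_min' (hex d) h
  have hρlt : ∀ d n, ρ d < n ↔ d.1 ∈ B ∪ Cseq n := fun d n => by
    cases n with
    | zero => exact ⟨fun h => absurd h (by omega), fun h => absurd h d.2⟩
    | succ n => rw [Nat.lt_succ_iff, hρ]
  have : Countable {a // a ∉ S} := by
    refine ((countable_iUnion hCcount).mono fun a ha => ?_).to_subtype
    obtain ⟨n, hn⟩ := hex ⟨a, ha⟩
    exact mem_iUnion.2 ⟨n + 1, hn⟩
  choose Λ hΛc _ hΛZ hΛφ using fun n => hφsep (n + 1) (Nat.le_add_left 1 n)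
  let r : ∀ n, ((A → ℝ) × (↥S → ℝ)) × ({a // a ∉ S} → ℝ) →
      (↥(B ∪ Cseq (n + 1)) → ℝ) × (↥(B ∪ Cseq (n + 1)) → ℝ) :=
    fun n w => resToP (B ∪ Cseq (n + 1)) (e.symm w)
  have hr : ∀ n, Continuous (r n) := fun n => (continuous_resToP _).comp e.symm.continuous
  have hSn : ∀ n, S ⊆ B ∪ Cseq n := fun n => union_subset_union_right B (hmono n.zero_le)
  let cut : ℕ → ({a // a ∉ S} → ℝ) → {a // a ∉ S} → ℝ := fun n y d => if ρ d < n then y d else 0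
  have hcut : ∀ n, Continuous (cut n) := fun n => by
    refine continuous_pi fun d => ?_
    by_cases h : ρ d < n <;> simp only [cut, h, if_true, if_false] <;> fun_prop
  let σ : ℕ → ((A → ℝ) × (↥S → ℝ)) × ({a // a ∉ S} → ℝ) → {a // a ∉ S} → ℝ := fun n w d =>
    if h : d.1 ∈ B ∪ Cseq (n + 1) then (φ (n + 1) (r n (w.1, cut n w.2))).2 ⟨d, h⟩ else 0
  have hσ : ∀ n, Continuous (σ n) := fun n => by
    refine continuous_pi fun d => ?_
    by_cases h : d.1 ∈ B ∪ Cseq (n + 1)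
    · simp only [σ, h, dif_pos]
      have := hφc (n + 1)
      have := hr n
      have := hcut n
      fun_prop
    · simp only [σ, h, dif_neg, not_false_eq_true]
      fun_prop
  have hlam_le : ∀ n t y y', (∀ d, ρ d ≤ n → y d = y' d) →
      Λ n (r n (t, y)) = Λ n (r n (t, y')) := by
    intro n t y y' h
    have : r n (t, y) = r n (t, y') := by
      refine Prod.ext rfl (funext fun a => ?_)
      change (e.symm (t, y)).2 a.1 = (e.symm (t, y')).2 a.1
      by_cases ha : a.1 ∈ S
      · rw [splitHomeomorph_symm_snd_of_mem _ ha, splitHomeomorph_symm_snd_of_mem _ ha]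
      · rw [splitHomeomorph_symm_snd_of_notMem _ ha, splitHomeomorph_symm_snd_of_notMem _ ha]
        exact h _ ((hρ _ _).2 a.2)
    simp only [this]
  have hσ_lt : ∀ n t y y', (∀ d, ρ d < n → y d = y' d) → σ n (t, y) = σ n (t, y') := by
    intro n t y y' h
    have : cut n y = cut n y' := funext fun d => by
      by_cases hd : ρ d < n
      · simp only [cut, hd, if_true, h d hd]
      · simp only [cut, hd, if_false]
    simp only [σ, this]
  have hlam1 : ∀ n w, (∀ d, ρ d = n → w.2 d = σ n w d) → Λ n (r n w) = 1 := by
    intro n w h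
    refine hΛφ n _ ⟨r n (w.1, cut n w.2), ?_⟩
    refine Prod.ext (hφ1 _ (Nat.le_add_left 1 n) _) (funext fun a => ?_)
    change _ = (e.symm w).2 a.1
    by_cases han : a.1 ∈ B ∪ Cseq n
    · have h1 := congrFun (congrArg Prod.snd (hφinv n (r n (w.1, cut n w.2)))) ⟨a.1, han⟩
      refine h1.trans ?_
      change (e.symm (w.1, cut n w.2)).2 a.1 = _
      by_cases ha : a.1 ∈ S
      · rw [splitHomeomorph_symm_snd_of_mem _ ha, splitHomeomorph_symm_snd_of_mem _ ha]
      · rw [splitHomeomorph_symm_snd_of_notMem _ ha, splitHomeomorph_symm_snd_of_notMem _ ha]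
        exact if_pos ((hρlt ⟨a, ha⟩ n).2 han)
    · have ha : a.1 ∉ S := fun h => han (hSn n h)
      have h1 : ρ ⟨a, ha⟩ = n :=
        le_antisymm ((hρ _ _).2 a.2) (not_lt.1 fun h => han ((hρlt _ _).1 h))
      rw [splitHomeomorph_symm_snd_of_notMem _ ha, h _ h1]
      simp only [σ, dif_pos a.2]
  have hlam0 : ∀ n, ∀ z ∈ e '' Z, Λ n (r n z) = 0 := by
    rintro n _ ⟨z, hz, rfl⟩
    refine hΛZ n _ ⟨z, hz, ?_⟩
    simp only [r, Homeomorph.symm_apply_apply]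
  obtain ⟨Ψ, hΨ1, hΨ⟩ := exists_deficient_homeomorph_of_holes ρ
    (fun n => (hΛc n).comp (hr n)) hσ hlam_le hσ_lt hlam1 (hZ.image e) hlam0
  refine ⟨e.trans Ψ, fun x => ?_, fun z hz => hΨ _ (mem_image_of_mem e hz)⟩
  rw [Homeomorph.trans_apply, hΨ1]
  rfl

/-- An autohomeomorphism of `ℝ^S × ℝ^S` over the first factor acts on `ℝ^A × ℝ^S`. -/
def extendHomeomorph {S : Set A} (H₀ : ((↥S → ℝ) × (↥S → ℝ)) ≃ₜ ((↥S → ℝ) × (↥S → ℝ)))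
    (hH₀ : ∀ x, (H₀ x).1 = x.1) : ((A → ℝ) × (↥S → ℝ)) ≃ₜ ((A → ℝ) × (↥S → ℝ)) where
  toFun w := (w.1, (H₀ (resTo S w.1, w.2)).2)
  invFun w := (w.1, (H₀.symm (resTo S w.1, w.2)).2)
  left_inv w := by
    have h : (resTo S w.1, (H₀ (resTo S w.1, w.2)).2) = H₀ (resTo S w.1, w.2) :=
      Prod.ext (hH₀ (resTo S w.1, w.2)).symm rfl
    simp only [h, Homeomorph.symm_apply_apply]
  right_inv w := by
    have h1 := hH₀ (H₀.symm (resTo S w.1, w.2))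
    rw [Homeomorph.apply_symm_apply] at h1
    have h : (resTo S w.1, (H₀.symm (resTo S w.1, w.2)).2) = H₀.symm (resTo S w.1, w.2) :=
      Prod.ext h1 rfl
    simp only [h, Homeomorph.apply_symm_apply]
  continuous_toFun := by
    have := continuous_resTo S
    fun_prop
  continuous_invFun := by
    have := continuous_resTo S
    fun_prop

end Product

/-- Fiberwise unknotting in `ℝ^{B∪C} × ℝ^{B∪C}` over a given base homeomorphism `H₀`:
the homeomorphism `f|Z : Z → F` extends to an autohomeomorphism `H` with `π₁ ∘ H = π₁`
and `(π_B × π_B) ∘ H = H₀ ∘ (π_B × π_B)`. -/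
theorem fiberwise_limit_unknotting_over_base
    (A : Type u) (B : Set A)
    (Cseq : ℕ → Set A) (hCcount : ∀ n, (Cseq n).Countable)
    (hCmono : ∀ n, Cseq n ⊆ Cseq (n + 1)) (hC0 : Cseq 0 = ∅)
    (hcover : B ∪ (⋃ n, Cseq n) = Set.univ)
    (Z F : Set ((A → ℝ) × (A → ℝ))) (hZcl : IsClosed Z) (hFcl : IsClosed F)
    (φ ψ : ∀ n, (↥(B ∪ Cseq n) → ℝ) × (↥(B ∪ Cseq n) → ℝ) →
      (↥(B ∪ Cseq n) → ℝ) × (↥(B ∪ Cseq n) → ℝ))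
    (hφc : ∀ n, Continuous (φ n)) (hψc : ∀ n, Continuous (ψ n))
    (hφ1 : ∀ n, 1 ≤ n → ∀ x, (φ n x).1 = x.1)
    (hψ1 : ∀ n, 1 ≤ n → ∀ x, (ψ n x).1 = x.1)
    (hφinv : ∀ n, ∀ x, resSubP (Set.union_subset_union_right B (hCmono n)) (φ (n + 1) x) =
      resSubP (Set.union_subset_union_right B (hCmono n)) x)
    (hψinv : ∀ n, ∀ x, resSubP (Set.union_subset_union_right B (hCmono n)) (ψ (n + 1) x) =
      resSubP (Set.union_subset_union_right B (hCmono n)) x)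
    (hφsep : ∀ n, 1 ≤ n →
      FunctionallySeparated (resToP (B ∪ Cseq n) '' Z) (Set.range (φ n)))
    (hψsep : ∀ n, 1 ≤ n →
      FunctionallySeparated (resToP (B ∪ Cseq n) '' F) (Set.range (ψ n)))
    (H₀ : ((↥(B ∪ Cseq 0) → ℝ) × (↥(B ∪ Cseq 0) → ℝ)) ≃ₜ
      ((↥(B ∪ Cseq 0) → ℝ) × (↥(B ∪ Cseq 0) → ℝ)))
    (hH₀1 : ∀ x, (H₀ x).1 = x.1)
    (f g : (A → ℝ) × (A → ℝ) → (A → ℝ) × (A → ℝ))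
    (hfc : Continuous f) (hgc : Continuous g)
    (hfZ : f '' Z = F) (hgF : g '' F = Z)
    (hgf : ∀ z ∈ Z, g (f z) = z) (hfg : ∀ y ∈ F, f (g y) = y)
    (hf1 : ∀ x, (f x).1 = x.1) (hg1 : ∀ x, (g x).1 = x.1)
    (hfB : ∀ x, resToP (B ∪ Cseq 0) (f x) = H₀ (resToP (B ∪ Cseq 0) x))
    (hgB : ∀ x, resToP (B ∪ Cseq 0) (g x) = H₀.symm (resToP (B ∪ Cseq 0) x)) :
    ∃ H : ((A → ℝ) × (A → ℝ)) ≃ₜ ((A → ℝ) × (A → ℝ)),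
      (∀ z ∈ Z, H z = f z) ∧ (∀ x, (H x).1 = x.1) ∧
      ∀ x, resToP (B ∪ Cseq 0) (H x) = H₀ (resToP (B ∪ Cseq 0) x) := by
  let S : Set A := B ∪ Cseq 0
  let p : (A → ℝ) × (A → ℝ) → (A → ℝ) × (↥S → ℝ) := fun x => (x.1, resTo S x.2)
  let τ := extendHomeomorph H₀ hH₀1
  suffices h : ∃ H : ((A → ℝ) × (A → ℝ)) ≃ₜ ((A → ℝ) × (A → ℝ)),
      (∀ z ∈ Z, H z = f z) ∧ ∀ x, p (H x) = τ (p x) by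
    obtain ⟨H, hHf, hHp⟩ := h
    have hH1 : ∀ x, (H x).1 = x.1 := fun x => (Prod.ext_iff.1 (hHp x)).1
    refine ⟨H, hHf, hH1, fun x => Prod.ext ?_ (Prod.ext_iff.1 (hHp x)).2⟩
    rw [hH₀1]
    exact congrArg (resTo S) (hH1 x)
  rcases Z.eq_empty_or_nonempty with rfl | hZ
  · refine ⟨((splitHomeomorph S).trans (τ.prodCongr (Homeomorph.refl _))).trans
      (splitHomeomorph S).symm, fun z hz => hz.elim, fun x => ?_⟩
    exact congrArg Prod.fst ((splitHomeomorph S).apply_symm_apply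
      ((τ.prodCongr (Homeomorph.refl _)) (splitHomeomorph S x)))
  · have hF : F.Nonempty := hfZ ▸ hZ.image f
    obtain ⟨hZd, hZp, hZ0⟩ := exists_deficient_homeomorph_of_separated B Cseq hCcount hCmono
      hcover hZ φ hφc hφ1 hφinv hφsep
    obtain ⟨hFd, hFp, hF0⟩ := exists_deficient_homeomorph_of_separated B Cseq hCcount hCmono
      hcover hF ψ hψc hψ1 hψinv hψsep
    exact exists_klee_homeomorph p τ hfc hgc
      (fun x => Prod.ext (hf1 x) (Prod.ext_iff.1 (hfB x)).2)
      (fun z hz => hfZ ▸ mem_image_of_mem f hz) hgf hZd hFd hZp hFp hZ0 hF0
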